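/- Let $V$ be a finite set of vehicles, equipped with a fixed strict total order (the priority order), and $T$ a finite set of tasks. Each task $t\in T$ has an appraisement $a_t>0$; each vehicle $v\in V$ has a task set $T_v\subseteq T$ and a bid $b_v>0$; let $B>0$ be a budget. For $W\subseteq V$ put $A(W)=\sum_{t\in\bigcup_{v\in W}T_v}a_t$, $\bar P(W)=A(W)-\sum_{v\in W}b_v$, $A(v|W)=A(W\cup\{v\})-A(W)$ and $\hat P(v|W)=\bigl(\bar P(W\cup\{v\})-\bar P(W)\bigr)/b_v$. In every greedy selection below, ties among maximizers are broken by choosing the maximizer that comes first in the priority order, the same order being used in both stages. *Winner allocation stage.* Start with $X=\emptyset$, $s=0$. While $X\ne V$, let $v^*\in V\setminus X$ maximize $\hat P(v|X)$; stop if $\hat P(v^*|X)<0$ or $s+b_{v^*}>B$; otherwise add $v^*$ to $X$ and $b_{v^*}$ to $s$. Let $X_L$ be the final set $X$ (the winner set). *Payment stage.* For each winner $i\in X_L$, start with $Y_0=\emptyset$ and, while $Y_{j-1}\neq V\setminus\{i\}$ (for $j=1,2,\dots$), let $u_j\in (V\setminus\{i\})\setminus Y_{j-1}$ maximize $\hat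 P(v|Y_{j-1})$; stop if $\hat P(u_j|Y_{j-1})<0$ or $\sum_{k<j}b_{u_k}+b_i>B$; otherwise put $Y_j=Y_{j-1}\cup\{u_j\}$. Let $L_i\ge 0$ be the number of vehicles selected. The payment $p_i$ is the maximum of the numbers $b_{u_j}A(i|Y_{j-1})/A(u_j|Y_{j-1})$, $1\le j\le L_i$, together with the number $A(i|Y_{L_i})$ in the case that $\sum_{k\le L_i}b_{u_k}+b_i\le B$. Then $$A(X_L)\ \ge\ \sum_{i\in X_L}p_i ,$$ that is, the buyer's profit $P(X_L)=A(X_L)-\sum_{i\in X_L}p_i$ is nonnegative. -/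

import Mathlib

/-- Total appraisement of the tasks covered by the vehicle set `W`:
`A(W) = Σ_{t ∈ ⋃_{i∈W} T_i} a_t`. -/
noncomputable def Aval {V T : Type*} [DecidableEq T]
    (a : T → ℝ) (Ts : V → Finset T) (W : Finset V) : ℝ :=
  ∑ t ∈ W.biUnion Ts, a t

/-- Profit-at-bids: `P̄(W) = A(W) − Σ_{i∈W} b_i`. -/
noncomputable def Pbar {V T : Type*} [DecidableEq T]
    (a : T → ℝ) (Ts : V → Finset T) (b : V → ℝ) (W : Finset V) : ℝ :=
  Aval a Ts W - ∑ i ∈ W, b i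

/-- Marginal coverage value `A(v|W) = A(W ∪ {v}) − A(W)`. -/
noncomputable def margA {V T : Type*} [DecidableEq V] [DecidableEq T]
    (a : T → ℝ) (Ts : V → Finset T) (v : V) (W : Finset V) : ℝ :=
  Aval a Ts (insert v W) - Aval a Ts W

/-- Marginal profit-at-bids `P̄(v|W) = P̄(W ∪ {v}) − P̄(W)`. -/
noncomputable def margP {V T : Type*} [DecidableEq V] [DecidableEq T]
    (a : T → ℝ) (Ts : V → Finset T) (b : V → ℝ) (v : V) (W : Finset V) : ℝ :=
  Pbar a Ts b (insert v W) - Pbar a Ts b W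

/-- Unit marginal gain `P̂(v|W) = P̄(v|W)/b_v`. -/
noncomputable def unitGain {V T : Type*} [DecidableEq V] [DecidableEq T]
    (a : T → ℝ) (Ts : V → Finset T) (b : V → ℝ) (v : V) (W : Finset V) : ℝ :=
  margP a Ts b v W / b v

/-- The set of maximizers of `f` over `F`. -/
noncomputable def argmaxSet {V : Type*} (f : V → ℝ) (F : Finset V) : Finset V :=
  F.filter (fun v => ∀ w ∈ F, f w ≤ f v)

/-- The maximizer of `f` over `F` selected by the fixed tie-breaking rule: among the
maximizers, the one that comes first in the priority order on the vehicles.  It is `none`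
exactly if `F` is empty. -/
noncomputable def pickMax {V : Type*} [LinearOrder V] (f : V → ℝ) (F : Finset V) : Option V :=
  if h : (argmaxSet f F).Nonempty then some ((argmaxSet f F).min' h) else none

/-- Greedy selection used by both TBSAP stages: from ground set `G`, with budget `B`,
accumulated spending `s` and current selection list `X` (in selection order), repeatedly
select `v* ∈ G ∖ X` maximizing `P̂(v|X)`; stop if there is none, if `P̂(v*|X) < 0`, or if
`s + chk v* > B`; otherwise append `v*` to `X` and add `b_{v*}` to `s`.  The winner
allocation stage checks the budget with `chk = b`, the payment stage for vehicle `i` with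
the constant `chk = b_i`.  The natural number bounds the number of iterations; `|V|` is
always enough, since each iteration adds a new vehicle. -/
noncomputable def tbsapSel {V T : Type*} [LinearOrder V] [DecidableEq T]
    (a : T → ℝ) (Ts : V → Finset T) (b : V → ℝ) (B : ℝ) (chk : V → ℝ)
    (G : Finset V) : ℕ → List V → ℝ → List V
  | 0, X, _ => X
  | n + 1, X, s =>
    match pickMax (fun v => unitGain a Ts b v X.toFinset) (G \ X.toFinset) with
    | none => X
    | some v =>
      if unitGain a Ts b v X.toFinset < 0 ∨ B < s + chk v then X
      else tbsapSel a Ts b B chk G n (X ++ [v]) (s + b v)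

/-- TBSAP winner allocation stage: the list `[v₁, …, v_L]` in selection order. -/
noncomputable def tbsapWinnerList {V T : Type*} [Fintype V] [LinearOrder V] [DecidableEq T]
    (a : T → ℝ) (Ts : V → Finset T) (b : V → ℝ) (B : ℝ) : List V :=
  tbsapSel a Ts b B b Finset.univ (Fintype.card V) [] 0

/-- The winner set `X_L = {v₁, …, v_L}`. -/
noncomputable def tbsapWinners {V T : Type*} [Fintype V] [LinearOrder V] [DecidableEq T]
    (a : T → ℝ) (Ts : V → Finset T) (b : V → ℝ) (B : ℝ) : Finset V :=
  (tbsapWinnerList a Ts b B).toFinset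

/-- TBSAP payment-stage greedy over `V₋ᵢ = V ∖ {i}`: the list `[v_{i_1}, …, v_{i_{L_i}}]`,
where `L_i` is the largest index with `P̂(v_{i_{L_i}}|Y_{L_i−1}) ≥ 0` and
`Σ_{j≤L_i−1} b_{i_j} + b_i ≤ B`. -/
noncomputable def tbsapPaymentList {V T : Type*} [Fintype V] [LinearOrder V] [DecidableEq T]
    (a : T → ℝ) (Ts : V → Finset T) (b : V → ℝ) (B : ℝ) (i : V) : List V :=
  tbsapSel a Ts b B (fun _ => b i) (Finset.univ.erase i) (Fintype.card V) [] 0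

/-- The replacement bids `b_{i_j} · A(v_i|Y_{j−1}) / A(v_{i_j}|Y_{j−1})` along a selection
list whose earlier selections form `Y`. -/
noncomputable def candList {V T : Type*} [DecidableEq V] [DecidableEq T]
    (a : T → ℝ) (Ts : V → Finset T) (b : V → ℝ) (i : V) :
    List V → Finset V → List ℝ
  | [], _ => []
  | v :: rest, Y =>
    (b v * margA a Ts i Y / margA a Ts v Y) :: candList a Ts b i rest (insert v Y)

/-- All the quantities whose maximum is the payment of vehicle `i`: the replacement bids
for `1 ≤ j ≤ L_i` and, if `Σ_{j≤L_i} b_{i_j} + b_i ≤ B`, also `A(v_i|Y_{L_i})`. -/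
noncomputable def paymentCands {V T : Type*} [Fintype V] [LinearOrder V] [DecidableEq T]
    (a : T → ℝ) (Ts : V → Finset T) (b : V → ℝ) (B : ℝ) (i : V) : List ℝ :=
  let Y := tbsapPaymentList a Ts b B i
  if (Y.map b).sum + b i ≤ B then margA a Ts i Y.toFinset :: candList a Ts b i Y ∅
  else candList a Ts b i Y ∅

/-- The TBSAP payment `p_i`, the maximum of `paymentCands`.  The default value is not used
for a winner `i`: a winner has `b_i ≤ B`, so if the payment-stage list is empty, then
`A(v_i|∅)` is among the candidates. -/
noncomputable def tbsapPayment {V T : Type*} [Fintype V] [LinearOrder V] [DecidableEq T]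
    (a : T → ℝ) (Ts : V → Finset T) (b : V → ℝ) (B : ℝ) (i : V) : ℝ :=
  (paymentCands a Ts b B i).max?.getD 0

/-- The buyer's profit `P(X_L) = A(X_L) − Σ_{v_i ∈ X_L} p_i`. -/
noncomputable def tbsapProfit {V T : Type*} [Fintype V] [LinearOrder V] [DecidableEq T]
    (a : T → ℝ) (Ts : V → Finset T) (b : V → ℝ) (B : ℝ) : ℝ :=
  Aval a Ts (tbsapWinners a Ts b B) - ∑ i ∈ tbsapWinners a Ts b B, tbsapPayment a Ts b B i

section Marginals

variable {V T : Type*} [LinearOrder V] [DecidableEq T]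
  {a : T → ℝ} {Ts : V → Finset T} {b : V → ℝ}

lemma margA_eq_sum_sdiff (a : T → ℝ) (Ts : V → Finset T) (v : V) (W : Finset V) :
    margA a Ts v W = ∑ t ∈ Ts v \ W.biUnion Ts, a t := by
  unfold margA Aval
  rw [Finset.biUnion_insert, ← Finset.sdiff_union_self_eq_union,
    Finset.sum_union Finset.sdiff_disjoint]
  ring

lemma margA_nonneg (ha : ∀ t, 0 < a t) (v : V) (W : Finset V) : 0 ≤ margA a Ts v W := by
  rw [margA_eq_sum_sdiff]
  exact Finset.sum_nonneg fun t _ => (ha t).le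

/-- Submodularity of the coverage value. -/
lemma margA_anti (ha : ∀ t, 0 < a t) (v : V) {W W' : Finset V} (h : W ⊆ W') :
    margA a Ts v W' ≤ margA a Ts v W := by
  rw [margA_eq_sum_sdiff, margA_eq_sum_sdiff]
  exact Finset.sum_le_sum_of_subset_of_nonneg
    (Finset.sdiff_subset_sdiff subset_rfl (Finset.biUnion_subset_biUnion_of_subset_left _ h))
    fun t _ _ => (ha t).le

lemma unitGain_eq (hb : ∀ i, 0 < b i) {v : V} {W : Finset V} (hv : v ∉ W) :
    unitGain a Ts b v W = margA a Ts v W / b v - 1 := by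
  have := (hb v).ne'
  unfold unitGain margP Pbar margA
  rw [Finset.sum_insert hv]
  field_simp
  ring

lemma bid_le_margA (hb : ∀ i, 0 < b i) {v : V} {W : Finset V} (hv : v ∉ W)
    (h : ¬ unitGain a Ts b v W < 0) : b v ≤ margA a Ts v W := by
  rw [unitGain_eq hb hv, not_lt, sub_nonneg, one_le_div (hb v)] at h
  exact h

end Marginals

section PickMax

lemma mem_argmaxSet {V : Type*} {f : V → ℝ} {F : Finset V} {v : V} :
    v ∈ argmaxSet f F ↔ v ∈ F ∧ ∀ w ∈ F, f w ≤ f v :=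
  Finset.mem_filter

variable {V : Type*} [LinearOrder V]

lemma pickMax_eq_some_iff {f : V → ℝ} {F : Finset V} {v : V} :
    pickMax f F = some v ↔ v ∈ argmaxSet f F ∧ ∀ w ∈ argmaxSet f F, v ≤ w := by
  unfold pickMax
  split_ifs with h
  · rw [Option.some_inj]
    constructor
    · rintro rfl
      exact ⟨Finset.min'_mem _ h, fun w hw => Finset.min'_le _ w hw⟩
    · rintro ⟨hv, hle⟩
      exact le_antisymm (Finset.min'_le _ v hv) (hle _ (Finset.min'_mem _ h))
  · simp only [false_iff]
    exact fun hv => h ⟨v, hv.1⟩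

/-- Removing an element that is not the selected one does not change the selection. -/
lemma pickMax_erase {f : V → ℝ} {F : Finset V} {v i : V} (h : pickMax f F = some v)
    (hne : v ≠ i) : pickMax f (F.erase i) = some v := by
  rw [pickMax_eq_some_iff] at h ⊢
  obtain ⟨hv, hmin⟩ := h
  rw [mem_argmaxSet] at hv
  refine ⟨mem_argmaxSet.2 ⟨Finset.mem_erase.2 ⟨hne, hv.1⟩,
    fun w hw => hv.2 w (Finset.mem_of_mem_erase hw)⟩, fun w hw => hmin w ?_⟩
  rw [mem_argmaxSet] at hw ⊢
  exact ⟨Finset.mem_of_mem_erase hw.1, fun u hu =>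
    (hv.2 u hu).trans (hw.2 v (Finset.mem_erase.2 ⟨hne, hv.1⟩))⟩

end PickMax

section Greedy

variable {V T : Type*} [LinearOrder V] [DecidableEq T]
  {a : T → ℝ} {Ts : V → Finset T} {b : V → ℝ} {B : ℝ}

/-- One round of the greedy selection: it either stops or appends the selected vehicle. -/
lemma tbsapSel_succ_cases (a : T → ℝ) (Ts : V → Finset T) (b : V → ℝ) (B : ℝ) (chk : V → ℝ)
    (G : Finset V) (n : ℕ) (X : List V) (s : ℝ) :
    tbsapSel a Ts b B chk G (n + 1) X s = X ∨
    ∃ v, pickMax (fun v => unitGain a Ts b v X.toFinset) (G \ X.toFinset) = some v ∧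
      ¬ unitGain a Ts b v X.toFinset < 0 ∧ s + chk v ≤ B ∧
      tbsapSel a Ts b B chk G (n + 1) X s = tbsapSel a Ts b B chk G n (X ++ [v]) (s + b v) := by
  rw [tbsapSel]
  split
  · exact Or.inl rfl
  · rename_i v hv
    split_ifs with h
    · exact Or.inl rfl
    · rw [not_or, not_lt (b := s + chk v)] at h
      exact Or.inr ⟨v, hv, h.1, h.2, rfl⟩

lemma tbsapSel_succ_of_pickMax {chk : V → ℝ} {G : Finset V} {X : List V} {s : ℝ} {v : V}
    (n : ℕ) (hv : pickMax (fun v => unitGain a Ts b v X.toFinset) (G \ X.toFinset) = some v)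
    (hg : ¬ unitGain a Ts b v X.toFinset < 0) (hs : s + chk v ≤ B) :
    tbsapSel a Ts b B chk G (n + 1) X s = tbsapSel a Ts b B chk G n (X ++ [v]) (s + b v) := by
  rw [tbsapSel]
  simp only [hv]
  rw [if_neg (not_or.2 ⟨hg, not_lt.2 hs⟩)]

lemma toFinset_append_singleton (X : List V) (v : V) :
    (X ++ [v]).toFinset = insert v X.toFinset := by
  ext; simp

lemma candList_append (i : V) (D E : List V) (Y : Finset V) :
    candList a Ts b i (D ++ E) Y =
      candList a Ts b i D Y ++ candList a Ts b i E (D.toFinset ∪ Y) := by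
  induction D generalizing Y with
  | nil => simp [candList]
  | cons d D ih => simp [candList, ih]

/-- The selection extends its starting list, and every replacement bid of `i` against a newly
selected vehicle is at most the marginal value of `i` at the start. -/
lemma exists_tbsapSel_eq_append (ha : ∀ t, 0 < a t) (hb : ∀ i, 0 < b i) (chk : V → ℝ)
    (G : Finset V) (i : V) (n : ℕ) (X : List V) (s : ℝ) :
    ∃ D, tbsapSel a Ts b B chk G n X s = X ++ D ∧
      ∀ c ∈ candList a Ts b i D X.toFinset, c ≤ margA a Ts i X.toFinset := by
  induction n generalizing X s with
  | zero => exact ⟨[], by simp [tbsapSel], by simp [candList]⟩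
  | succ n ih =>
    rcases tbsapSel_succ_cases a Ts b B chk G n X s with h | ⟨v, hv, hg, -, h⟩
    · exact ⟨[], by simpa using h, by simp [candList]⟩
    · obtain ⟨D, hD, hc⟩ := ih (X ++ [v]) (s + b v)
      rw [pickMax_eq_some_iff, mem_argmaxSet] at hv
      have hbv := bid_le_margA hb (Finset.mem_sdiff.1 hv.1.1).2 hg
      refine ⟨v :: D, by rw [h, hD]; simp, ?_⟩
      rw [toFinset_append_singleton] at hc
      intro c hmem
      rw [candList, List.mem_cons] at hmem
      rcases hmem with rfl | hmem
      · rw [div_le_iff₀ ((hb v).trans_le hbv), mul_comm]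
        exact mul_le_mul_of_nonneg_left hbv (margA_nonneg ha _ _)
      · exact (hc c hmem).trans (margA_anti ha i (Finset.subset_insert _ _))

/-- Comparison of the two stages: until the winner `i` is selected, the payment stage for `i`
makes the same selections as the allocation stage, and the replacement bids of `i` against the
vehicles selected before it are at most `b i`. -/
lemma payment_stage_follows_allocation [Fintype V] (ha : ∀ t, 0 < a t) (hb : ∀ i, 0 < b i)
    {i : V} {Q : List V} (n : ℕ) (X D : List V) (s : ℝ)
    (h : tbsapSel a Ts b B b Finset.univ n X s = X ++ (D ++ i :: Q)) (hi : i ∉ X ++ D) :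
    b i ≤ margA a Ts i (X ++ D).toFinset ∧ s + (D.map b).sum + b i ≤ B ∧
      (∀ c ∈ candList a Ts b i D X.toFinset, c ≤ b i) ∧
      ∃ m, tbsapSel a Ts b B (fun _ => b i) (Finset.univ.erase i) n X s =
        tbsapSel a Ts b B (fun _ => b i) (Finset.univ.erase i) m (X ++ D)
          (s + (D.map b).sum) := by
  induction n generalizing X D s with
  | zero => simp [tbsapSel] at h
  | succ n ih =>
    rcases tbsapSel_succ_cases a Ts b B b Finset.univ n X s with h' | ⟨v, hv, hg, hs, h'⟩
    · simp [h'] at h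
    · have hv' := hv
      rw [pickMax_eq_some_iff, mem_argmaxSet] at hv'
      have hvX := (Finset.mem_sdiff.1 hv'.1.1).2
      have hbv := bid_le_margA hb hvX hg
      obtain ⟨E, hE, -⟩ := exists_tbsapSel_eq_append (B := B) (Ts := Ts) ha hb b Finset.univ i n
        (X ++ [v]) (s + b v)
      rw [h'] at h
      have hEq := hE.symm.trans h
      rw [List.append_assoc, List.append_cancel_left_eq] at hEq
      cases D with
      | nil =>
        obtain rfl : v = i := by simpa using congrArg List.head? hEq
        exact ⟨by simpa using hbv, by simpa using hs, by simp [candList], n + 1, by simp⟩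
      | cons d D =>
        obtain rfl : v = d := by simpa using congrArg List.head? hEq
        have hne : v ≠ i := by rintro rfl; simp at hi
        have hiX : i ∉ X.toFinset := by
          intro hmem; exact hi (List.mem_append_left _ (List.mem_toFinset.1 hmem))
        have hassoc : X ++ v :: D = X ++ [v] ++ D := by simp
        have hsum : s + ((v :: D).map b).sum = s + b v + (D.map b).sum := by
          simp [add_assoc]
        obtain ⟨h₁, h₂, h₃, m, hm⟩ := ih (X ++ [v]) D (s + b v)
          (by rw [h]; simp) (by rwa [← hassoc])
        rw [hassoc, hsum]
        refine ⟨h₁, h₂, ?_, m, ?_⟩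
        · intro c hc
          rw [candList, List.mem_cons] at hc
          rcases hc with rfl | hc
          · have hle := hv'.1.2 i (by simpa using hiX)
            rw [unitGain_eq hb hiX, unitGain_eq hb hvX, sub_le_sub_iff_right,
              div_le_div_iff₀ (hb i) (hb v)] at hle
            rw [div_le_iff₀ ((hb v).trans_le hbv)]
            linarith
          · exact h₃ c (by rwa [toFinset_append_singleton])
        · rw [← hm]
          refine tbsapSel_succ_of_pickMax n ?_ hg ?_
          · rw [Finset.erase_sdiff_comm]
            exact pickMax_erase hv hne
          · have hD : 0 ≤ (D.map b).sum := List.sum_nonneg fun x hx => by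
              obtain ⟨w, -, rfl⟩ := List.mem_map.1 hx
              exact (hb w).le
            linarith [hb v]

lemma sum_le_Aval_of_le_margA (a : T → ℝ) (Ts : V → Finset T) (f : V → ℝ) (L : List V)
    (h : ∀ P i Q, L = P ++ i :: Q → i ∉ P → f i ≤ margA a Ts i P.toFinset) :
    ∑ i ∈ L.toFinset, f i ≤ Aval a Ts L.toFinset := by
  induction L using List.reverseRecOn with
  | nil => simp [Aval]
  | append_singleton L v ih =>
    have hL := ih fun P i Q hPQ => h P i (Q ++ [v]) (by simp [hPQ])
    rw [toFinset_append_singleton]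
    by_cases hv : v ∈ L
    · rwa [Finset.insert_eq_of_mem (List.mem_toFinset.2 hv)]
    · rw [Finset.sum_insert (by simpa using hv)]
      have hfv := h L v [] rfl hv
      unfold margA at hfv
      linarith

end Greedy

section Profit

variable {V T : Type*} [Fintype V] [LinearOrder V] [DecidableEq T]
  {a : T → ℝ} {Ts : V → Finset T} {b : V → ℝ} {B : ℝ}

/-- The payment of a winner is at most its marginal value when it was selected. -/
lemma tbsapPayment_le_margA (ha : ∀ t, 0 < a t) (hb : ∀ i, 0 < b i) {P Q : List V} {i : V}
    (h : tbsapWinnerList a Ts b B = P ++ i :: Q) (hi : i ∉ P) :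
    tbsapPayment a Ts b B i ≤ margA a Ts i P.toFinset := by
  obtain ⟨hbi, -, hbefore, m, hm⟩ :=
    payment_stage_follows_allocation ha hb (Fintype.card V) [] P 0 h hi
  obtain ⟨E, hE, hafter⟩ := exists_tbsapSel_eq_append (B := B) (Ts := Ts) ha hb (fun _ => b i)
    (Finset.univ.erase i) i m ([] ++ P) (0 + (P.map b).sum)
  have hY : tbsapPaymentList a Ts b B i = P ++ E := hm.trans hE
  rw [List.nil_append] at hbi hafter
  have hcand : ∀ c ∈ candList a Ts b i (P ++ E) ∅, c ≤ margA a Ts i P.toFinset := by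
    intro c hc
    rw [candList_append, Finset.union_empty, List.mem_append] at hc
    exact hc.elim (fun hc => (hbefore c hc).trans hbi) (hafter c)
  have hall : ∀ c ∈ paymentCands a Ts b B i, c ≤ margA a Ts i P.toFinset := by
    intro c hc
    simp only [paymentCands, hY] at hc
    split_ifs at hc
    · rcases List.mem_cons.1 hc with rfl | hc
      · exact margA_anti ha i (by rw [List.toFinset_append]; exact Finset.subset_union_left)
      · exact hcand c hc
    · exact hcand c hc
  unfold tbsapPayment
  cases hmax : (paymentCands a Ts b B i).max? with
  | none => exact margA_nonneg ha _ _
  | some p => exact hall p (List.max?_mem hmax)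

end Profit

/-- Profitability of TBSAP.  The linear order on `V` is the priority order that breaks ties
in both stages. -/
theorem tbsap_profitable {V T : Type*} [Fintype V] [LinearOrder V] [DecidableEq T]
    (a : T → ℝ) (Ts : V → Finset T) (b : V → ℝ) (B : ℝ)
    (ha : ∀ t, 0 < a t) (hb : ∀ i, 0 < b i) (hB : 0 < B) :
    ∑ i ∈ tbsapWinners a Ts b B, tbsapPayment a Ts b B i ≤
        Aval a Ts (tbsapWinners a Ts b B) ∧
      0 ≤ tbsapProfit a Ts b B := by
  have h : ∑ i ∈ tbsapWinners a Ts b B, tbsapPayment a Ts b B i ≤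
      Aval a Ts (tbsapWinners a Ts b B) :=
    sum_le_Aval_of_le_margA a Ts _ _ fun _ _ _ hPQ hi => tbsapPayment_le_margA ha hb hPQ hi
  exact ⟨h, sub_nonneg.2 h⟩
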